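/- arXiv:2211.00608 — 3 statements merged into one kernel-verified Lean document; each statement's English description precedes it below -/
import Mathlib

section
/- Let φ : ℝ → ℝ be slope-restricted in the sector [α, β] with 0 ≤ α < β < ∞, i.e., α(a − b)² ≤ (a − b)(φ(a) − φ(b)) ≤ β(a − b)² for all a, b ∈ ℝ. Let Φ : ℝᴺ → ℝᴺ apply φ entrywise, let T be an N×N diagonal matrix with nonnegative diagonal entries, and let p, q ∈ ℝᴺ. Setting z = p − q and d = Φ(p) − Φ(q), the incremental quadratic constraint −2αβ · zᵀT z + 2(α + β) · zᵀ T d − 2 · dᵀ T d ≥ 0 holds; equivalently, the vector (z, d) ∈ ℝ²ᴺ satisfies (z, d)ᵀ [[−2αβT, (α+β)T], [(α+β)T, −2T]] (z, d) ≥ 0. -/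
/-- A function that is slope-restricted in `[α, β]` has increments in the sector `[α, β]`. -/
theorem sector_of_slope_restricted {φ : ℝ → ℝ} {α β : ℝ} {a b : ℝ}
    (hl : α * (a - b) ^ 2 ≤ (a - b) * (φ a - φ b))
    (hu : (a - b) * (φ a - φ b) ≤ β * (a - b) ^ 2) :
    0 ≤ (φ a - φ b - α * (a - b)) * (β * (a - b) - (φ a - φ b)) := by
  rcases eq_or_ne a b with rfl | hab
  · simp
  · have hsq : 0 < (a - b) ^ 2 := by
      have := sub_ne_zero.2 hab
      positivity
    refine nonneg_of_mul_nonneg_right ?_ hsq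
    linear_combination mul_nonneg (sub_nonneg.2 hl) (sub_nonneg.2 hu)

/-- Incremental quadratic constraint for slope-restricted activations.
If `φ` is slope-restricted in `[α, β]` (`0 ≤ α < β`), `T` is a diagonal matrix with
nonnegative entries, and `z = p - q`, `d = Φ(p) - Φ(q)` (entrywise `Φ = φ`), then
`-2αβ·zᵀTz + 2(α+β)·zᵀTd - 2·dᵀTd ≥ 0`. -/
theorem slope_restricted_quadratic_constraint {N : ℕ} (φ : ℝ → ℝ) (α β : ℝ)
    (hα : 0 ≤ α) (hαβ : α < β)
    (hslope : ∀ a b : ℝ,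
      α * (a - b) ^ 2 ≤ (a - b) * (φ a - φ b) ∧ (a - b) * (φ a - φ b) ≤ β * (a - b) ^ 2)
    (T : Fin N → ℝ) (hT : ∀ i, 0 ≤ T i) (p q : Fin N → ℝ) :
    0 ≤ -2 * α * β * (∑ i, T i * (p i - q i) ^ 2)
        + 2 * (α + β) * (∑ i, T i * (p i - q i) * (φ (p i) - φ (q i)))
        - 2 * (∑ i, T i * (φ (p i) - φ (q i)) ^ 2) := by
  have hterm : ∀ i, 0 ≤ 2 * (T i * ((φ (p i) - φ (q i) - α * (p i - q i)) *
      (β * (p i - q i) - (φ (p i) - φ (q i))))) := fun i =>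
    mul_nonneg zero_le_two (mul_nonneg (hT i)
      (sector_of_slope_restricted (hslope (p i) (q i)).1 (hslope (p i) (q i)).2))
  refine (Finset.sum_nonneg (s := Finset.univ) fun i _ => hterm i).trans_eq ?_
  rw [Finset.mul_sum, Finset.mul_sum, Finset.mul_sum, ← Finset.sum_add_distrib,
    ← Finset.sum_sub_distrib]
  exact Finset.sum_congr rfl fun i _ => by ring
end

section
/- Let φ : ℝ → ℝ be slope-restricted in the sector [α, β] with 0 ≤ α < β < ∞, and let Φ apply φ entrywise. Let A_F, B_F ∈ ℝ^{N×m}, C_F ∈ ℝ^{1×m}, D_F ∈ ℝ^{n×m} be real matrices, T an N×N diagonal matrix with nonnegative diagonal entries, and ρ > 0. Define M¹ = [A_F; B_F]ᵀ [[−2αβT, (α+β)T], [(α+β)T, −2T]] [A_F; B_F] and M² = C_Fᵀ C_F − ρ D_Fᵀ D_F, and suppose M¹ + M² is negative semidefinite. Then for any ξ, ξ̄ ∈ ℝᵐ satisfying the network constraints B_F ξ = Φ(A_F ξ) and B_F ξ̄ = Φ(A_F ξ̄), one has (C_F ξ − C_F ξ̄)² ≤ ρ ‖D_F ξ − D_F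 ξ̄‖₂²; in particular |C_F ξ − C_F ξ̄| ≤ √ρ · ‖D_F(ξ − ξ̄)‖₂. -/
open Matrix

theorem slope_restricted_sector_nonneg {φ : ℝ → ℝ} {α β : ℝ}
    (hslope : ∀ a b : ℝ,
      α * (a - b) ^ 2 ≤ (a - b) * (φ a - φ b) ∧ (a - b) * (φ a - φ b) ≤ β * (a - b) ^ 2)
    (a b : ℝ) :
    0 ≤ (φ a - φ b - α * (a - b)) * (β * (a - b) - (φ a - φ b)) := by
  rcases eq_or_ne a b with rfl | hab
  · simp
  · have hpos : 0 < (a - b) ^ 2 := by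
      have := sub_ne_zero.mpr hab
      positivity
    obtain ⟨hlower, hupper⟩ := hslope a b
    refine nonneg_of_mul_nonneg_right ?_ hpos
    calc
      0 ≤ ((a - b) * (φ a - φ b) - α * (a - b) ^ 2) *
          (β * (a - b) ^ 2 - (a - b) * (φ a - φ b)) :=
        mul_nonneg (sub_nonneg.mpr hlower) (sub_nonneg.mpr hupper)
      _ = _ := by ring

theorem dotProduct_transpose_mul_mul_mulVec {ι κ R : Type*} [Fintype ι] [Fintype κ]
    [CommSemiring R] (S : Matrix ι κ R) (M : Matrix ι ι R) (x : κ → R) :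
    x ⬝ᵥ (Sᵀ * M * S).mulVec x = S.mulVec x ⬝ᵥ M.mulVec (S.mulVec x) := by
  rw [← mulVec_mulVec, ← mulVec_mulVec, dotProduct_mulVec, vecMul_transpose]

theorem dotProduct_transpose_mul_self_mulVec {ι κ R : Type*} [Fintype ι] [Fintype κ]
    [CommSemiring R] (S : Matrix ι κ R) (x : κ → R) :
    x ⬝ᵥ (Sᵀ * S).mulVec x = ∑ i, S.mulVec x i ^ 2 := by
  rw [← mulVec_mulVec, dotProduct_mulVec, vecMul_transpose]
  simp only [dotProduct, sq]

theorem sector_multiplier_quadratic_form {ι : Type*} [Fintype ι] [DecidableEq ι]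
    (α β : ℝ) (T u v : ι → ℝ) :
    Sum.elim u v ⬝ᵥ (Matrix.fromBlocks (-(2 * α * β) • Matrix.diagonal T)
        ((α + β) • Matrix.diagonal T) ((α + β) • Matrix.diagonal T)
        ((-2 : ℝ) • Matrix.diagonal T)).mulVec (Sum.elim u v) =
      2 * ∑ i, T i * ((v i - α * u i) * (β * u i - v i)) := by
  rw [fromBlocks_mulVec, sumElim_dotProduct_sumElim]
  simp only [Sum.elim_comp_inl, Sum.elim_comp_inr, dotProduct, Pi.add_apply, smul_mulVec,
    Pi.smul_apply, mulVec_diagonal, smul_eq_mul]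
  rw [← Finset.sum_add_distrib, Finset.mul_sum]
  exact Finset.sum_congr rfl fun i _ => by ring

/-- If `M¹ + M² ⪯ 0` where
`M¹ = [A_F; B_F]ᵀ [[−2αβT, (α+β)T], [(α+β)T, −2T]] [A_F; B_F]` and
`M² = C_Fᵀ C_F − ρ D_Fᵀ D_F` (`T` diagonal with nonnegative entries, `ρ > 0`, `φ`
slope-restricted in `[α, β]`), then any `ξ, ξ̄` satisfying the network constraints
`B_F ξ = Φ(A_F ξ)` and `B_F ξ̄ = Φ(A_F ξ̄)` obey
`(C_F ξ − C_F ξ̄)² ≤ ρ ‖D_F(ξ − ξ̄)‖₂²`, hence `|C_F ξ − C_F ξ̄| ≤ √ρ ‖D_F(ξ − ξ̄)‖₂`. -/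
theorem lmi_implies_incremental_bound {N m p : ℕ} (φ : ℝ → ℝ) (α β : ℝ)
    (hα : 0 ≤ α) (hαβ : α < β)
    (hslope : ∀ a b : ℝ,
      α * (a - b) ^ 2 ≤ (a - b) * (φ a - φ b) ∧ (a - b) * (φ a - φ b) ≤ β * (a - b) ^ 2)
    (A_F B_F : Matrix (Fin N) (Fin m) ℝ) (C_F : Matrix (Fin 1) (Fin m) ℝ)
    (D_F : Matrix (Fin p) (Fin m) ℝ)
    (T : Fin N → ℝ) (hT : ∀ i, 0 ≤ T i) (ρ : ℝ) (hρ : 0 < ρ)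
    (hNSD : ∀ x : Fin m → ℝ,
      x ⬝ᵥ (((Matrix.fromRows A_F B_F).transpose *
            Matrix.fromBlocks (-(2 * α * β) • Matrix.diagonal T)
              ((α + β) • Matrix.diagonal T) ((α + β) • Matrix.diagonal T)
              ((-2 : ℝ) • Matrix.diagonal T) *
            Matrix.fromRows A_F B_F +
          (C_F.transpose * C_F - ρ • (D_F.transpose * D_F))).mulVec x) ≤ 0)
    (ξ ξ' : Fin m → ℝ)
    (hξ : B_F.mulVec ξ = fun i => φ (A_F.mulVec ξ i))
    (hξ' : B_F.mulVec ξ' = fun i => φ (A_F.mulVec ξ' i)) :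
    (C_F.mulVec ξ 0 - C_F.mulVec ξ' 0) ^ 2
        ≤ ρ * ∑ j, (D_F.mulVec ξ j - D_F.mulVec ξ' j) ^ 2 ∧
      |C_F.mulVec ξ 0 - C_F.mulVec ξ' 0|
        ≤ Real.sqrt ρ * Real.sqrt (∑ j, (D_F.mulVec ξ j - D_F.mulVec ξ' j) ^ 2) := by
  have hform := hNSD (ξ - ξ')
  rw [add_mulVec, sub_mulVec, smul_mulVec, dotProduct_add, dotProduct_sub, dotProduct_smul,
    dotProduct_transpose_mul_mul_mulVec, dotProduct_transpose_mul_self_mulVec,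
    dotProduct_transpose_mul_self_mulVec, fromRows_mulVec,
    sector_multiplier_quadratic_form, Fin.sum_univ_one] at hform
  simp only [mulVec_sub, Pi.sub_apply, smul_eq_mul, hξ, hξ'] at hform
  have hsector := Finset.sum_nonneg fun i (_ : i ∈ Finset.univ) =>
    mul_nonneg (hT i) (slope_restricted_sector_nonneg hslope (A_F.mulVec ξ i) (A_F.mulVec ξ' i))
  have hbound : (C_F.mulVec ξ 0 - C_F.mulVec ξ' 0) ^ 2
      ≤ ρ * ∑ j, (D_F.mulVec ξ j - D_F.mulVec ξ' j) ^ 2 := by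
    linarith
  refine ⟨hbound, ?_⟩
  rw [← Real.sqrt_mul hρ.le]
  exact Real.abs_le_sqrt hbound
end

section
/- (Theorem 1) Consider an L-layer fully connected neural network f : ℝ^{n₀} → ℝ^{n_{L+1}} given by f(x) = W^L Φ(W^{L−1} Φ(⋯ Φ(W⁰ x))) with weight matrices W^k ∈ ℝ^{n_{k+1} × n_k} for k = 0, …, L, where Φ applies entrywise an activation function φ that is slope-restricted in the sector [α, β] with 0 ≤ α < β < ∞. Let A ∈ ℝ^{n_x × n_x}, B ∈ ℝ^{n_x × n_{L+1}} with n₀ = n_x, let R ∈ ℝ^{n_x × n_x} be orthonormal, and let c ∈ ℝ^{n_x}. Set N = Σ_{i=1}^{L} n_i and define A_F = [blkdiag(W⁰R, W¹, …, W^{L−1}), 0_{N×n_L}] ∈ ℝ^{N×(n₀+N)}, B_F = [0_{N×n₀}, I_N] ∈ ℝ^{N×(n₀+N)}, C_F = [cᵀ A R, 0_{1×(N−n_L)}, cᵀ B W^L] ∈ ℝ^{1×(n₀+N)}, and D_F = [I_{n₀}, 0_{n₀×N}] ∈ ℝ^{n₀×(n₀+N)}. Suppose there exist ρ > 0 and an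 N×N diagonal positive semidefinite matrix T such that the matrix [A_F; B_F]ᵀ [[−2αβT, (α+β)T], [(α+β)T, −2T]] [A_F; B_F] + C_Fᵀ C_F − ρ D_Fᵀ D_F is negative semidefinite. Then √ρ is a Lipschitz constant in the Euclidean norm of the function J_c(y) = cᵀ(A R y + B f(R y)), i.e., |J_c(y) − J_c(ȳ)| ≤ √ρ ‖y − ȳ‖₂ for all y, ȳ ∈ ℝ^{n₀}. -/
open Matrix

/-- The signal after `k` activation layers of the network with dimensions `d` and
weights `W`: `layerSig d W φ x 0 = x` and
`layerSig d W φ x (k+1) = Φ(W^k (layerSig d W φ x k))`. -/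
def layerSig (d : ℕ → ℕ) (W : ∀ k : ℕ, Matrix (Fin (d (k + 1))) (Fin (d k)) ℝ)
    (φ : ℝ → ℝ) (x : Fin (d 0) → ℝ) : (k : ℕ) → (Fin (d k) → ℝ)
  | 0 => x
  | k + 1 => fun i => φ (((W k).mulVec (layerSig d W φ x k)) i)

/-- The `L`-layer fully connected network
`f(x) = W^L Φ(W^{L-1} Φ(⋯ Φ(W⁰ x)))`. -/
def nnet (d : ℕ → ℕ) (W : ∀ k : ℕ, Matrix (Fin (d (k + 1))) (Fin (d k)) ℝ)
    (φ : ℝ → ℝ) (L : ℕ) (x : Fin (d 0) → ℝ) : Fin (d (L + 1)) → ℝ :=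
  (W L).mulVec (layerSig d W φ x L)

/-- `A_F = [blkdiag(W⁰R, W¹, …, W^{L−1}), 0_{N×n_L}]`, acting on the stacked vector
`ξ = (ξ⁰, …, ξ^L)`; rows are indexed by the hidden blocks `1, …, L` and columns by the
blocks `0, …, L`. -/
def AFmat (d : ℕ → ℕ) (L : ℕ) (W : ∀ k : ℕ, Matrix (Fin (d (k + 1))) (Fin (d k)) ℝ)
    (R : Matrix (Fin (d 0)) (Fin (d 0)) ℝ) :
    Matrix ((k : Fin L) × Fin (d ((k : ℕ) + 1))) ((k : Fin (L + 1)) × Fin (d (k : ℕ))) ℝ :=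
  Matrix.of fun p q =>
    if h : (q.1 : ℕ) = (p.1 : ℕ) then
      if h0 : (p.1 : ℕ) = 0 then
        (W 0 * R) (Fin.cast (by rw [h0]) p.2) (Fin.cast (by rw [h, h0]) q.2)
      else (W (p.1 : ℕ)) p.2 (Fin.cast (by rw [h]) q.2)
    else 0

/-- `B_F = [0_{N×n₀}, I_N]` acting on the stacked vector `ξ = (ξ⁰, …, ξ^L)`. -/
def BFmat (d : ℕ → ℕ) (L : ℕ) :
    Matrix ((k : Fin L) × Fin (d ((k : ℕ) + 1))) ((k : Fin (L + 1)) × Fin (d (k : ℕ))) ℝ :=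
  Matrix.of fun p q =>
    if (q.1 : ℕ) = (p.1 : ℕ) + 1 ∧ (q.2 : ℕ) = (p.2 : ℕ) then 1 else 0

/-- `C_F = [cᵀAR, 0_{1×(N−n_L)}, cᵀBW^L]` as a `1 × (n₀+N)` matrix. -/
def CFmat (d : ℕ → ℕ) (L : ℕ) (W : ∀ k : ℕ, Matrix (Fin (d (k + 1))) (Fin (d k)) ℝ)
    (A : Matrix (Fin (d 0)) (Fin (d 0)) ℝ) (B : Matrix (Fin (d 0)) (Fin (d (L + 1))) ℝ)
    (R : Matrix (Fin (d 0)) (Fin (d 0)) ℝ) (c : Fin (d 0) → ℝ) :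
    Matrix (Fin 1) ((k : Fin (L + 1)) × Fin (d (k : ℕ))) ℝ :=
  Matrix.of fun _ q =>
    if h0 : (q.1 : ℕ) = 0 then Matrix.vecMul c (A * R) (Fin.cast (by rw [h0]) q.2)
    else if hL : (q.1 : ℕ) = L then Matrix.vecMul c (B * W L) (Fin.cast (by rw [hL]) q.2)
    else 0

/-- `D_F = [I_{n₀}, 0_{n₀×N}]` acting on the stacked vector `ξ = (ξ⁰, …, ξ^L)`. -/
def DFmat (d : ℕ → ℕ) (L : ℕ) :
    Matrix (Fin (d 0)) ((k : Fin (L + 1)) × Fin (d (k : ℕ))) ℝ :=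
  Matrix.of fun i q => if (q.1 : ℕ) = 0 ∧ (q.2 : ℕ) = (i : ℕ) then 1 else 0

theorem sector_of_slope {α β δ Δ : ℝ} (h₁ : α * δ ^ 2 ≤ δ * Δ) (h₂ : δ * Δ ≤ β * δ ^ 2)
    (h₀ : δ = 0 → Δ = 0) : 0 ≤ (Δ - α * δ) * (β * δ - Δ) := by
  by_cases hδ : δ = 0
  · simp [hδ, h₀ hδ]
  · have hpos : 0 < δ ^ 2 := by positivity
    have h := mul_nonneg (sub_nonneg.2 h₁) (sub_nonneg.2 h₂)
    have e : (δ * Δ - α * δ ^ 2) * (β * δ ^ 2 - δ * Δ) =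
        δ ^ 2 * ((Δ - α * δ) * (β * δ - Δ)) := by ring
    rw [e] at h
    exact nonneg_of_mul_nonneg_right h hpos

/-- The vector `(v⁰, …, v^L)` obtained by stacking the first `L + 1` blocks of `v`. -/
def stack (d : ℕ → ℕ) (L : ℕ) (v : ∀ k : ℕ, Fin (d k) → ℝ) :
    ((k : Fin (L + 1)) × Fin (d (k : ℕ))) → ℝ :=
  fun q => v q.1 q.2

theorem AFmat_mulVec_stack (d : ℕ → ℕ) (L : ℕ)
    (W : ∀ k : ℕ, Matrix (Fin (d (k + 1))) (Fin (d k)) ℝ)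
    (R : Matrix (Fin (d 0)) (Fin (d 0)) ℝ) (v w : ∀ k : ℕ, Fin (d k) → ℝ)
    (h0 : w 0 = R *ᵥ v 0) (hs : ∀ k, w (k + 1) = v (k + 1))
    (p : (k : Fin L) × Fin (d ((k : ℕ) + 1))) :
    (AFmat d L W R *ᵥ stack d L v) p = (W p.1 *ᵥ w p.1) p.2 := by
  obtain ⟨⟨k, hk⟩, i⟩ := p
  rw [Matrix.mulVec, dotProduct, Fintype.sum_sigma,
    Finset.sum_eq_single (⟨k, by omega⟩ : Fin (L + 1))]
  · cases k with
    | zero =>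
      change _ = (W 0 *ᵥ w 0) i
      rw [h0, Matrix.mulVec_mulVec]
      simp [AFmat, stack, Matrix.mulVec, dotProduct]
    | succ k => simp [AFmat, stack, hs, Matrix.mulVec, dotProduct]
  · intro b _ hb
    have hne : (b : ℕ) ≠ k := fun h => hb (Fin.ext h)
    simp [AFmat, hne]
  · simp

theorem BFmat_mulVec_stack (d : ℕ → ℕ) (L : ℕ) (v : ∀ k : ℕ, Fin (d k) → ℝ)
    (p : (k : Fin L) × Fin (d ((k : ℕ) + 1))) :
    (BFmat d L *ᵥ stack d L v) p = v (p.1 + 1) p.2 := by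
  obtain ⟨⟨k, hk⟩, i⟩ := p
  rw [Matrix.mulVec, dotProduct, Fintype.sum_sigma,
    Finset.sum_eq_single (⟨k + 1, by omega⟩ : Fin (L + 1))]
  · simp [BFmat, stack, Fin.val_inj]
  · intro b _ hb
    have hne : (b : ℕ) ≠ k + 1 := fun h => hb (Fin.ext h)
    simp [BFmat, hne]
  · simp

theorem CFmat_mulVec_stack (d : ℕ → ℕ) (L : ℕ) (hL : 0 < L)
    (W : ∀ k : ℕ, Matrix (Fin (d (k + 1))) (Fin (d k)) ℝ)
    (A : Matrix (Fin (d 0)) (Fin (d 0)) ℝ) (B : Matrix (Fin (d 0)) (Fin (d (L + 1))) ℝ)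
    (R : Matrix (Fin (d 0)) (Fin (d 0)) ℝ) (c : Fin (d 0) → ℝ)
    (v : ∀ k : ℕ, Fin (d k) → ℝ) (i : Fin 1) :
    (CFmat d L W A B R c *ᵥ stack d L v) i =
      c ⬝ᵥ (A *ᵥ (R *ᵥ v 0) + B *ᵥ (W L *ᵥ v L)) := by
  rw [Matrix.mulVec, dotProduct, Fintype.sum_sigma,
    Finset.sum_eq_add (0 : Fin (L + 1)) (Fin.last L)]
  · rw [Matrix.mulVec_mulVec, Matrix.mulVec_mulVec, dotProduct_add,
      Matrix.dotProduct_mulVec, Matrix.dotProduct_mulVec]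
    simp [CFmat, stack, dotProduct, hL.ne']
    rfl
  · exact fun h => hL.ne (congrArg Fin.val h)
  · intro b _ hb
    have h0 : (b : ℕ) ≠ 0 := fun h => hb.1 (Fin.ext h)
    have h1 : (b : ℕ) ≠ L := fun h => hb.2 (Fin.ext h)
    simp [CFmat, h1, Fin.val_eq_zero_iff.not.1 h0]
  · simp
  · simp

theorem DFmat_mulVec_stack (d : ℕ → ℕ) (L : ℕ) (v : ∀ k : ℕ, Fin (d k) → ℝ) :
    DFmat d L *ᵥ stack d L v = v 0 := by
  ext i
  rw [Matrix.mulVec, dotProduct, Fintype.sum_sigma, Finset.sum_eq_single (0 : Fin (L + 1))]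
  · simp only [DFmat, stack, Matrix.of_apply, Fin.val_zero, true_and, Fin.val_inj, ite_mul,
      one_mul, zero_mul]
    exact (Finset.sum_ite_eq' Finset.univ i (v 0)).trans (if_pos (Finset.mem_univ i))
  · intro b _ hb
    simp [DFmat, hb]
  · exact fun h => absurd (Finset.mem_univ _) h

theorem dotProduct_transpose_mul_mul_mulVec_s10 {m n : Type*} [Fintype m] [Fintype n]
    (M : Matrix m n ℝ) (Q : Matrix m m ℝ) (x : n → ℝ) :
    x ⬝ᵥ ((Mᵀ * Q * M) *ᵥ x) = (M *ᵥ x) ⬝ᵥ (Q *ᵥ (M *ᵥ x)) := by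
  rw [← Matrix.mulVec_mulVec, ← Matrix.mulVec_mulVec, Matrix.dotProduct_mulVec,
    Matrix.vecMul_transpose]

theorem dotProduct_transpose_mul_self_mulVec_s10 {m n : Type*} [Fintype m] [Fintype n]
    (M : Matrix m n ℝ) (x : n → ℝ) :
    x ⬝ᵥ ((Mᵀ * M) *ᵥ x) = (M *ᵥ x) ⬝ᵥ (M *ᵥ x) := by
  rw [← Matrix.mulVec_mulVec, Matrix.dotProduct_mulVec, Matrix.vecMul_transpose]

/-- The quadratic form of the sector multiplier is a weighted sum of sector products. -/
theorem sumElim_dotProduct_sector_mulVec {m : Type*} [Fintype m] [DecidableEq m]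
    (α β : ℝ) (T a b : m → ℝ) :
    Sum.elim a b ⬝ᵥ (Matrix.fromBlocks (-(2 * α * β) • Matrix.diagonal T)
        ((α + β) • Matrix.diagonal T) ((α + β) • Matrix.diagonal T)
        ((-2 : ℝ) • Matrix.diagonal T) *ᵥ Sum.elim a b) =
      ∑ p, 2 * T p * ((b p - α * a p) * (β * a p - b p)) := by
  rw [Matrix.fromBlocks_mulVec, sumElim_dotProduct_sumElim, dotProduct, dotProduct,
    ← Finset.sum_add_distrib]
  refine Finset.sum_congr rfl fun p _ => ?_
  simp only [Sum.elim_comp_inl, Sum.elim_comp_inr, Matrix.smul_mulVec, Pi.add_apply,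
    Pi.smul_apply, Matrix.mulVec_diagonal, smul_eq_mul]
  ring

/-- Theorem 1: if the LMI
`[A_F; B_F]ᵀ [[−2αβT, (α+β)T], [(α+β)T, −2T]] [A_F; B_F] + C_Fᵀ C_F − ρ D_Fᵀ D_F ⪯ 0`
is feasible for some `ρ > 0` and diagonal PSD `T`, then `√ρ` is a Lipschitz constant in
the Euclidean norm of `J_c(y) = cᵀ(ARy + B f(Ry))`. -/
theorem lipschitz_constant_of_lmi (d : ℕ → ℕ) (L : ℕ) (hL : 0 < L)
    (W : ∀ k : ℕ, Matrix (Fin (d (k + 1))) (Fin (d k)) ℝ)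
    (φ : ℝ → ℝ) (α β : ℝ) (hα : 0 ≤ α) (hαβ : α < β)
    (hslope : ∀ a b : ℝ,
      α * (a - b) ^ 2 ≤ (a - b) * (φ a - φ b) ∧ (a - b) * (φ a - φ b) ≤ β * (a - b) ^ 2)
    (A : Matrix (Fin (d 0)) (Fin (d 0)) ℝ) (B : Matrix (Fin (d 0)) (Fin (d (L + 1))) ℝ)
    (R : Matrix (Fin (d 0)) (Fin (d 0)) ℝ) (hR : R.transpose * R = 1)
    (c : Fin (d 0) → ℝ)
    (T : ((k : Fin L) × Fin (d ((k : ℕ) + 1))) → ℝ) (hT : ∀ i, 0 ≤ T i)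
    (ρ : ℝ) (hρ : 0 < ρ)
    (hNSD : ∀ ξ : ((k : Fin (L + 1)) × Fin (d (k : ℕ))) → ℝ,
      ξ ⬝ᵥ (((Matrix.fromRows (AFmat d L W R) (BFmat d L)).transpose *
            Matrix.fromBlocks (-(2 * α * β) • Matrix.diagonal T)
              ((α + β) • Matrix.diagonal T) ((α + β) • Matrix.diagonal T)
              ((-2 : ℝ) • Matrix.diagonal T) *
            Matrix.fromRows (AFmat d L W R) (BFmat d L) +
          ((CFmat d L W A B R c).transpose * CFmat d L W A B R c -
            ρ • ((DFmat d L).transpose * DFmat d L))).mulVec ξ) ≤ 0) :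
    ∀ y ybar : Fin (d 0) → ℝ,
      |c ⬝ᵥ (A.mulVec (R.mulVec y) + B.mulVec (nnet d W φ L (R.mulVec y))) -
          c ⬝ᵥ (A.mulVec (R.mulVec ybar) + B.mulVec (nnet d W φ L (R.mulVec ybar)))|
        ≤ Real.sqrt ρ * Real.sqrt (∑ i, (y i - ybar i) ^ 2) := by
  intro y ybar
  set x := R *ᵥ y with hx
  set xbar := R *ᵥ ybar with hxbar
  let w : ∀ k : ℕ, Fin (d k) → ℝ := fun k => layerSig d W φ x k - layerSig d W φ xbar k
  let v : ∀ k : ℕ, Fin (d k) → ℝ := fun k =>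
    match k with
    | 0 => y - ybar
    | k + 1 => w (k + 1)
  have hvL : v L = w L := by
    obtain ⟨l, rfl⟩ := Nat.exists_eq_add_one.2 hL
    rfl
  have hAF := AFmat_mulVec_stack d L W R v w (Matrix.mulVec_sub R y ybar).symm fun _ => rfl
  have key := hNSD (stack d L v)
  rw [Matrix.add_mulVec, Matrix.sub_mulVec, Matrix.smul_mulVec, dotProduct_add, dotProduct_sub,
    dotProduct_smul, dotProduct_transpose_mul_mul_mulVec_s10, dotProduct_transpose_mul_self_mulVec_s10,
    dotProduct_transpose_mul_self_mulVec_s10, Matrix.fromRows_mulVec,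
    sumElim_dotProduct_sector_mulVec, DFmat_mulVec_stack] at key
  have hsector : 0 ≤ ∑ p, 2 * T p *
      (((BFmat d L *ᵥ stack d L v) p - α * (AFmat d L W R *ᵥ stack d L v) p) *
        (β * (AFmat d L W R *ᵥ stack d L v) p - (BFmat d L *ᵥ stack d L v) p)) := by
    refine Finset.sum_nonneg fun p _ => mul_nonneg (mul_nonneg zero_le_two (hT p)) ?_
    rw [hAF, BFmat_mulVec_stack]
    set s := (W p.1 *ᵥ layerSig d W φ x p.1) p.2
    set t := (W p.1 *ᵥ layerSig d W φ xbar p.1) p.2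
    have ha : (W p.1 *ᵥ w p.1) p.2 = s - t := by
      simp only [w, Matrix.mulVec_sub, Pi.sub_apply, s, t]
    have hb : v (p.1 + 1) p.2 = φ s - φ t := rfl
    rw [ha, hb]
    exact sector_of_slope (hslope s t).1 (hslope s t).2 fun h => by rw [sub_eq_zero.1 h, sub_self]
  have hout : c ⬝ᵥ (A *ᵥ x + B *ᵥ nnet d W φ L x) - c ⬝ᵥ (A *ᵥ xbar + B *ᵥ nnet d W φ L xbar) =
      c ⬝ᵥ (A *ᵥ (R *ᵥ v 0) + B *ᵥ (W L *ᵥ v L)) := by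
    rw [hvL, ← dotProduct_sub]
    simp only [v, w, nnet, Matrix.mulVec_sub, hx, hxbar]
    congr 1
    abel
  have hnorm : v 0 ⬝ᵥ v 0 = ∑ i, (y i - ybar i) ^ 2 :=
    Finset.sum_congr rfl fun i _ => (sq (y i - ybar i)).symm
  rw [hout, ← Real.sqrt_mul hρ.le, ← hnorm]
  refine Real.abs_le_sqrt ?_
  rw [dotProduct, Fin.sum_univ_one, CFmat_mulVec_stack d L hL, ← sq, smul_eq_mul] at key
  linarith
end
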